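/- Let F be a fully faithful covariant functor from the category of Giry algebras to the category of convex spaces. Then F is naturally isomorphic to the functor Φ which equips each Giry algebra with its induced convex structure: F(1) is a singleton {*} for the terminal Giry algebra 1, and for each Giry algebra (X,κ) the map τ_{X,κ} : X → F(X,κ) defined by τ_{X,κ}(α) = F(ᾱ)(*), where ᾱ : 1 → X is the constant morphism with value α, is a bijection which is affine from the induced convex structure on X to F(X,κ) and is natural: for every morphism u : (X,κ) → (Y,λ) of Giry algebras, F(u) ∘ τ_{X,κ} = τ_{Y,λ} ∘ u. -/

import Mathlib

namespace Paper

/-- A family of convex combination operations satisfies the axioms of a convex space: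
unit law, idempotency, parametric commutativity and deformed parametric associativity. -/
structure IsConvexStruct {A : Type*} (comb : unitInterval → A → A → A) : Prop where
  unit : ∀ x y, comb 0 x y = x
  idem : ∀ r x, comb r x x = x
  comm : ∀ r x y, comb r x y = comb (unitInterval.symm r) y x
  assoc : ∀ (r s t u : unitInterval), 0 < (s : ℝ) → (t : ℝ) = r + s - r * s →
    (u : ℝ) = (s : ℝ) / (t : ℝ) →
    ∀ x y z, comb s (comb r x y) z = comb t x (comb u y z)

section GiryMonad

open MeasureTheory

/-- The evaluation σ-algebra on the space `G(X)` of probability measures on `X`: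
the σ-algebra induced from the σ-algebra on measures generated by the evaluations
`φ ↦ φ K` for `K` measurable. -/
noncomputable instance {X : Type*} [MeasurableSpace X] :
    MeasurableSpace (ProbabilityMeasure X) :=
  MeasurableSpace.comap ProbabilityMeasure.toMeasure inferInstance

lemma measurable_toMeasure {X : Type*} [MeasurableSpace X] :
    Measurable (ProbabilityMeasure.toMeasure : ProbabilityMeasure X → Measure X) :=
  Measurable.of_comap_le le_rfl

/-- The Dirac measure as a probability measure: the unit of the Giry monad. -/
noncomputable def dirac {X : Type*} [MeasurableSpace X] (x : X) : ProbabilityMeasure X :=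
  ⟨Measure.dirac x, inferInstance⟩

/-- Pushforward of a probability measure along a measurable map (the action of the
Giry functor on morphisms): `G(f)(φ) = φ ∘ f⁻¹`. -/
noncomputable def pushforward {X Y : Type*} [MeasurableSpace X] [MeasurableSpace Y]
    (f : X → Y) (hf : Measurable f) (φ : ProbabilityMeasure X) : ProbabilityMeasure Y :=
  ⟨φ.toMeasure.map f, by
    constructor
    rw [Measure.map_apply hf MeasurableSet.univ]
    simp⟩

/-- The multiplication `μ_X : G(G(X)) → G(X)` of the Giry monad,
`μ_X(Φ)(K) = ∫ ξ(K) dΦ(ξ)`. -/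
noncomputable def join {X : Type*} [MeasurableSpace X]
    (Φ : ProbabilityMeasure (ProbabilityMeasure X)) : ProbabilityMeasure X :=
  ⟨(Φ.toMeasure.map ProbabilityMeasure.toMeasure).join, by
    constructor
    rw [Measure.join_apply MeasurableSet.univ,
      lintegral_map (Measure.measurable_coe MeasurableSet.univ) measurable_toMeasure]
    simp⟩

/-- The convex combination `φ +ᵣ ψ = (1-r)·φ + r·ψ` of two probability measures. -/
noncomputable def pcomb {X : Type*} [MeasurableSpace X] (r : unitInterval)
    (φ ψ : ProbabilityMeasure X) : ProbabilityMeasure X :=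
  ⟨ENNReal.ofReal (1 - (r : ℝ)) • φ.toMeasure + ENNReal.ofReal (r : ℝ) • ψ.toMeasure, by
    constructor
    simp only [Measure.coe_add, Measure.coe_smul, Pi.add_apply, Pi.smul_apply,
      measure_univ, smul_eq_mul, mul_one]
    rw [← ENNReal.ofReal_add (by linarith [r.2.2]) r.2.1]
    norm_num⟩

lemma integral_mem_unitInterval {X : Type*} [MeasurableSpace X] (φ : ProbabilityMeasure X)
    (f : X → ℝ) (h0 : ∀ x, 0 ≤ f x) (h1 : ∀ x, f x ≤ 1) :
    ∫ x, f x ∂φ.toMeasure ∈ unitInterval := by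
  refine ⟨integral_nonneg h0, ?_⟩
  have h := integral_mono_of_nonneg (μ := φ.toMeasure) (f := f) (g := fun _ => (1 : ℝ))
    (Filter.Eventually.of_forall h0) (integrable_const 1) (Filter.Eventually.of_forall h1)
  simpa using h

/-- The structure map `E : G(I) → I`, `E(ω) = ∫ x dω`, of the Giry algebra `(I, E)`. -/
noncomputable def Eop (ω : ProbabilityMeasure unitInterval) : unitInterval :=
  ⟨∫ x, (x : ℝ) ∂ω.toMeasure,
    integral_mem_unitInterval ω _ (fun x => x.2.1) (fun x => x.2.2)⟩

/-- The structure map `E_M : G(I^M) → I^M`, `E_M(φ)(m) = ∫ ev_m dφ`. -/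
noncomputable def EM (M : Type*) (φ : ProbabilityMeasure (M → unitInterval)) :
    M → unitInterval :=
  fun m => ⟨∫ α, (α m : ℝ) ∂φ.toMeasure,
    integral_mem_unitInterval φ _ (fun α => (α m).2.1) (fun α => (α m).2.2)⟩

end GiryMonad

open CategoryTheory

/-- An Eilenberg–Moore algebra over the Giry monad: a measurable space `carrier`
together with a measurable structure map `str : G(carrier) → carrier` satisfying
`str(δ_x) = x` and `str ∘ G(str) = str ∘ μ`. -/
structure GiryAlg : Type 1 where
  carrier : Type
  [meas : MeasurableSpace carrier]
  str : MeasureTheory.ProbabilityMeasure carrier → carrier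
  measurable_str : Measurable str
  str_dirac : ∀ x, str (dirac x) = x
  str_join : ∀ Φ : MeasureTheory.ProbabilityMeasure
      (MeasureTheory.ProbabilityMeasure carrier),
    str (pushforward str measurable_str Φ) = str (join Φ)

attribute [instance] GiryAlg.meas

/-- Morphisms of Giry algebras: measurable maps commuting with the structure maps,
`f ∘ κ = λ ∘ G(f)`. -/
def GiryHom (A B : GiryAlg) : Type :=
  {f : A.carrier → B.carrier //
    ∃ hf : Measurable f, ∀ φ, f (A.str φ) = B.str (pushforward f hf φ)}

section PushforwardLemmas

open MeasureTheory

lemma pushforward_id {X : Type*} [MeasurableSpace X] (φ : ProbabilityMeasure X) :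
    pushforward id measurable_id φ = φ := by
  apply Subtype.ext
  simp [pushforward]

lemma pushforward_comp {X Y Z : Type*} [MeasurableSpace X] [MeasurableSpace Y]
    [MeasurableSpace Z] {f : X → Y} {g : Y → Z} (hf : Measurable f) (hg : Measurable g)
    (φ : ProbabilityMeasure X) :
    pushforward (g ∘ f) (hg.comp hf) φ = pushforward g hg (pushforward f hf φ) := by
  apply Subtype.ext
  simp [pushforward, Measure.map_map hg hf]

end PushforwardLemmas

/-- The category of Giry algebras. -/
noncomputable instance : Category GiryAlg where
  Hom := GiryHom
  id A := ⟨id, measurable_id, fun φ => by rw [pushforward_id]; rfl⟩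
  comp {A B C} f g := ⟨g.1 ∘ f.1, by
    obtain ⟨hf, hf'⟩ := f.2
    obtain ⟨hg, hg'⟩ := g.2
    exact ⟨hg.comp hf, fun φ => by
      simp only [Function.comp_apply, hf', hg', pushforward_comp hf hg]⟩⟩
  id_comp f := rfl
  comp_id f := rfl
  assoc f g h := rfl

/-- A convex space: a set with convex combination operations satisfying the axioms. -/
structure CvxCat : Type 1 where
  carrier : Type
  comb : unitInterval → carrier → carrier → carrier
  is_convex : IsConvexStruct comb

/-- The category of convex spaces with affine maps. -/
noncomputable instance : Category CvxCat where
  Hom A B := {f : A.carrier → B.carrier //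
    ∀ (r : unitInterval) (x y : A.carrier), f (A.comb r x y) = B.comb r (f x) (f y)}
  id A := ⟨id, fun _ _ _ => rfl⟩
  comp {A B C} f g := ⟨g.1 ∘ f.1, fun r x y => by
    simp only [Function.comp_apply, f.2, g.2]⟩
  id_comp f := rfl
  comp_id f := rfl
  assoc f g h := rfl

/-- The terminal Giry algebra `1`: the one-point measurable space with its unique
structure map. -/
noncomputable def terminalGiry : GiryAlg where
  carrier := PUnit
  str := fun _ => PUnit.unit
  measurable_str := measurable_const
  str_dirac := fun _ => rfl
  str_join := fun _ => rfl

/-- The constant morphism `ᾱ : 1 → (X,κ)` with value `α`. -/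
noncomputable def constHom (A : GiryAlg) (α : A.carrier) : terminalGiry ⟶ A :=
  ⟨fun _ => α, measurable_const, fun φ => by
    have h : pushforward (fun _ => α) measurable_const φ = dirac α := by
      apply Subtype.ext
      simp [pushforward, dirac, MeasureTheory.Measure.map_const]
    rw [h, A.str_dirac]⟩

section WeightFunctions

open unitInterval

lemma le_of_multiplicative_of_symm {f : I → I} (hsymm : ∀ r, f (σ r) = σ (f r))
    (hmul : ∀ a b, f (a * b) = f a * f b) (x : I) : (x : ℝ) ≤ f x := by
  have hadd : ∀ a b c : I, (c : ℝ) = a + b → (f c : ℝ) = f a + f b := by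
    intro a b c h
    rcases eq_or_lt_of_le c.2.1 with hc | hc
    · have ha : a = 0 := Subtype.ext (by change (a : ℝ) = 0; linarith [a.2.1, b.2.1])
      have hb : b = 0 := Subtype.ext (by change (b : ℝ) = 0; linarith [a.2.1, b.2.1])
      have hc : c = 0 := Subtype.ext hc.symm
      subst ha hb hc
      have h1 : f 1 = σ (f 0) := by rw [← hsymm]; simp
      have h2 : f 0 * f 0 = f 0 := by rw [← hmul]; simp
      have h3 : f 0 * f 1 = f 0 := by rw [← hmul]; simp
      rw [h1] at h3
      have h2' := congrArg Subtype.val h2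
      have h3' := congrArg Subtype.val h3
      simp only [Set.Icc.coe_mul, coe_symm_eq] at h2' h3'
      linarith
    · let p : I := ⟨a / c, div_nonneg a.2.1 c.2.1,
        (div_le_one hc).2 (by linarith [b.2.1])⟩
      have hp : c * p = a := Subtype.ext (by
        change (c : ℝ) * (a / c) = a
        field_simp)
      have hq : c * σ p = b := Subtype.ext (by
        change (c : ℝ) * (1 - a / c) = b
        field_simp
        linarith)
      rw [← hp, ← hq, hmul, hmul, hsymm]
      simp only [Set.Icc.coe_mul, coe_symm_eq]
      ring
  have hmono : ∀ a b : I, a ≤ b → (f a : ℝ) ≤ f b := by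
    intro a b h
    have := hadd a ⟨b - a, sub_nonneg.2 h, by linarith [a.2.1, b.2.2]⟩ b (by simp)
    linarith [(f ⟨b - a, sub_nonneg.2 h, by linarith [a.2.1, b.2.2]⟩).2.1]
  have h0 : (f 0 : ℝ) = 0 := by
    have := hadd 0 0 0 (by simp)
    linarith
  have h1 : (f 1 : ℝ) = 1 := by
    have := congrArg Subtype.val (hsymm 0)
    simp only [symm_zero, coe_symm_eq] at this
    linarith
  have hnat : ∀ (a : I) (k : ℕ) (c : I), (c : ℝ) = k * a → (f c : ℝ) = k * f a := by
    intro a k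
    induction k with
    | zero =>
      intro c hc
      have : c = 0 := Subtype.ext (by simpa using hc)
      rw [this, h0]
      simp
    | succ k ih =>
      intro c hc
      push_cast at hc
      have hk : (0 : ℝ) ≤ k * a := mul_nonneg k.cast_nonneg a.2.1
      have hd : (k * a : ℝ) ∈ I := ⟨hk, by linarith [a.2.1, c.2.2]⟩
      rw [hadd ⟨k * a, hd⟩ a c (by rw [hc]; ring), ih ⟨k * a, hd⟩ rfl]
      push_cast
      ring
  by_contra! hlt
  obtain ⟨q, hq1, hq2⟩ := exists_rat_btwn hlt
  have hq0 : (0 : ℝ) < q := (f x).2.1.trans_lt hq1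
  have hqI : (q : ℝ) ∈ I := ⟨hq0.le, hq2.le.trans x.2.2⟩
  have hden : (1 : ℝ) ≤ q.den := by exact_mod_cast q.pos
  have hnI : (1 / q.den : ℝ) ∈ I :=
    ⟨by positivity, (div_le_one (by linarith)).2 hden⟩
  have hn := hnat ⟨_, hnI⟩ q.den 1 (by
    change (1 : ℝ) = q.den * (1 / q.den)
    field_simp)
  have hnum : ((q.num.toNat : ℕ) : ℝ) = q.num := by
    have : (0 : ℤ) ≤ q.num := Rat.num_nonneg.2 (by exact_mod_cast hq0.le)
    exact_mod_cast Int.toNat_of_nonneg this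
  have hqd : (q : ℝ) = q.num / q.den := Rat.cast_def q
  have hk := hnat ⟨_, hnI⟩ q.num.toNat ⟨q, hqI⟩ (by
    change (q : ℝ) = q.num.toNat * (1 / q.den)
    rw [hnum, hqd]
    ring)
  have hfq : (f ⟨q, hqI⟩ : ℝ) = q := by
    rw [h1] at hn
    have : (f ⟨_, hnI⟩ : ℝ) = 1 / q.den := by
      field_simp
      linarith
    rw [hk, this, hnum, hqd]
    ring
  have := hmono ⟨q, hqI⟩ x hq2.le
  linarith

lemma eq_self_of_multiplicative_of_symm {f : I → I} (hsymm : ∀ r, f (σ r) = σ (f r))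
    (hmul : ∀ a b, f (a * b) = f a * f b) (x : I) : f x = x := by
  have h := le_of_multiplicative_of_symm hsymm hmul (σ x)
  rw [hsymm] at h
  simp only [coe_symm_eq] at h
  exact Subtype.ext
    (le_antisymm (by linarith) (le_of_multiplicative_of_symm hsymm hmul x))

end WeightFunctions

section IntervalAlgebra

open MeasureTheory

lemma Eop_eq_toReal (ω : ProbabilityMeasure unitInterval) :
    (Eop ω : ℝ) = (∫⁻ x, ENNReal.ofReal (x : ℝ) ∂ω.toMeasure).toReal :=
  integral_eq_lintegral_of_nonneg_ae (Filter.Eventually.of_forall fun x => x.2.1)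
    measurable_subtype_coe.aestronglyMeasurable

lemma ofReal_Eop (ω : ProbabilityMeasure unitInterval) :
    ENNReal.ofReal (Eop ω) = ∫⁻ x, ENNReal.ofReal (x : ℝ) ∂ω.toMeasure := by
  rw [Eop_eq_toReal, ENNReal.ofReal_toReal]
  refine ne_top_of_le_ne_top ENNReal.one_ne_top ?_
  calc ∫⁻ x, ENNReal.ofReal (x : ℝ) ∂ω.toMeasure ≤ ∫⁻ _, 1 ∂ω.toMeasure :=
        lintegral_mono fun x => ENNReal.ofReal_le_one.2 x.2.2
    _ = 1 := by simp

lemma measurable_Eop : Measurable Eop := by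
  refine Measurable.subtype_mk (h := fun ω => (Eop ω).2) (f := fun ω => (Eop ω : ℝ)) ?_
  simp only [Eop_eq_toReal]
  exact ((Measure.measurable_lintegral
    (ENNReal.measurable_ofReal.comp measurable_subtype_coe)).comp
      measurable_toMeasure).ennreal_toReal

lemma Eop_dirac (x : unitInterval) : Eop (dirac x) = x := by
  apply Subtype.ext
  simp [Eop, dirac]

lemma lintegral_join_toMeasure {X : Type*} [MeasurableSpace X]
    (Φ : ProbabilityMeasure (ProbabilityMeasure X)) {g : X → ENNReal} (hg : Measurable g) :
    ∫⁻ x, g x ∂(join Φ).toMeasure = ∫⁻ φ, ∫⁻ x, g x ∂φ.toMeasure ∂Φ.toMeasure := by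
  change ∫⁻ x, g x ∂(Φ.toMeasure.map ProbabilityMeasure.toMeasure).join = _
  rw [Measure.lintegral_join hg.aemeasurable,
    lintegral_map (Measure.measurable_lintegral hg) measurable_toMeasure]

lemma Eop_join (Φ : ProbabilityMeasure (ProbabilityMeasure unitInterval)) :
    Eop (pushforward Eop measurable_Eop Φ) = Eop (join Φ) := by
  have hm : Measurable fun x : unitInterval => ENNReal.ofReal (x : ℝ) :=
    ENNReal.measurable_ofReal.comp measurable_subtype_coe
  apply Subtype.ext
  rw [Eop_eq_toReal, Eop_eq_toReal, lintegral_join_toMeasure Φ hm]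
  change (∫⁻ x, _ ∂(Φ.toMeasure.map Eop)).toReal = _
  rw [lintegral_map hm measurable_Eop]
  simp only [ofReal_Eop]

/-- The Giry algebra `(I, E)`. -/
noncomputable def intervalGiry : GiryAlg where
  carrier := unitInterval
  str := Eop
  measurable_str := measurable_Eop
  str_dirac := Eop_dirac
  str_join := Eop_join

lemma Eop_pcomb_dirac (r x y : unitInterval) :
    (Eop (pcomb r (dirac x) (dirac y)) : ℝ) = (1 - r) * x + r * y := by
  have hr := r.2.1
  have hr' : (0 : ℝ) ≤ 1 - r := sub_nonneg.2 r.2.2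
  rw [Eop_eq_toReal]
  have hx := x.2.1
  have hy := y.2.1
  simp only [pcomb, dirac, ProbabilityMeasure.coe_mk, lintegral_add_measure,
    lintegral_smul_measure, lintegral_dirac, smul_eq_mul]
  rw [← ENNReal.ofReal_mul hr', ← ENNReal.ofReal_mul hr,
    ← ENNReal.ofReal_add (by positivity) (by positivity),
    ENNReal.toReal_ofReal (by positivity)]

lemma measurable_pcomb {X : Type*} [MeasurableSpace X] (φ ψ : ProbabilityMeasure X) :
    Measurable fun r : unitInterval => pcomb r φ ψ := by
  refine measurable_comap_iff.2 (Measure.measurable_of_measurable_coe _ fun K _ => ?_)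
  change Measurable fun r : unitInterval =>
    ENNReal.ofReal (1 - (r : ℝ)) * φ.toMeasure K + ENNReal.ofReal (r : ℝ) * ψ.toMeasure K
  fun_prop

lemma pcomb_Eop {X : Type*} [MeasurableSpace X] (φ ψ : ProbabilityMeasure X)
    (ω : ProbabilityMeasure unitInterval) :
    pcomb (Eop ω) φ ψ = join (pushforward _ (measurable_pcomb φ ψ) ω) := by
  have hm : Measurable fun x : unitInterval => ENNReal.ofReal (x : ℝ) :=
    ENNReal.measurable_ofReal.comp measurable_subtype_coe
  have hm' : Measurable fun x : unitInterval => ENNReal.ofReal (1 - (x : ℝ)) := by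
    fun_prop
  have hsymm : ENNReal.ofReal (1 - (Eop ω : ℝ))
      = ∫⁻ x, ENNReal.ofReal (1 - (x : ℝ)) ∂ω.toMeasure := by
    have hsum : (∫⁻ x, ENNReal.ofReal (1 - (x : ℝ)) ∂ω.toMeasure)
        + ENNReal.ofReal (Eop ω) = 1 := by
      rw [ofReal_Eop, ← lintegral_add_left hm']
      have : ∀ x : unitInterval,
          ENNReal.ofReal (1 - (x : ℝ)) + ENNReal.ofReal (x : ℝ) = 1 := fun x => by
        rw [← ENNReal.ofReal_add (sub_nonneg.2 x.2.2) x.2.1]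
        simp
      simp [this]
    rw [ENNReal.ofReal_sub _ (Eop ω).2.1, ENNReal.ofReal_one, ← hsum,
      ENNReal.add_sub_cancel_right ENNReal.ofReal_ne_top]
  apply Subtype.ext
  refine Measure.ext fun K hK => ?_
  have hjoin : ((join (pushforward _ (measurable_pcomb φ ψ) ω)).toMeasure : Measure X) K
      = ∫⁻ r, (pcomb r φ ψ).toMeasure K ∂ω.toMeasure := by
    change (Measure.map ProbabilityMeasure.toMeasure
      (ω.toMeasure.map fun r => pcomb r φ ψ)).join K = _
    rw [Measure.join_apply hK, lintegral_map (Measure.measurable_coe hK) measurable_toMeasure]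
    exact lintegral_map ((Measure.measurable_coe hK).comp measurable_toMeasure)
      (measurable_pcomb φ ψ)
  refine Eq.trans ?_ hjoin.symm
  simp only [pcomb, ProbabilityMeasure.coe_mk, Measure.coe_add, Measure.coe_smul,
    Pi.add_apply, Pi.smul_apply, smul_eq_mul]
  rw [lintegral_add_left (by fun_prop), lintegral_mul_const _ hm', lintegral_mul_const _ hm,
    hsymm, ofReal_Eop]

lemma str_pcomb_Eop (A : GiryAlg) (φ ψ : ProbabilityMeasure A.carrier)
    (ω : ProbabilityMeasure unitInterval) :
    A.str (pcomb (Eop ω) φ ψ) = A.str (pushforward (fun r => A.str (pcomb r φ ψ))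
      (A.measurable_str.comp (measurable_pcomb φ ψ)) ω) := by
  rw [pcomb_Eop, ← A.str_join, ← pushforward_comp (measurable_pcomb _ _) A.measurable_str]
  rfl

/-- The morphism `I → (X,κ)`, `r ↦ κ((1-r)·δ_α + r·δ_β)`. -/
noncomputable def segmentHom (A : GiryAlg) (α β : A.carrier) : intervalGiry ⟶ A :=
  ⟨fun r => A.str (pcomb r (dirac α) (dirac β)),
    A.measurable_str.comp (measurable_pcomb _ _), str_pcomb_Eop A _ _⟩

lemma pcomb_zero {X : Type*} [MeasurableSpace X] (φ ψ : ProbabilityMeasure X) :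
    pcomb 0 φ ψ = φ := by
  apply Subtype.ext
  simp [pcomb]

lemma pcomb_one {X : Type*} [MeasurableSpace X] (φ ψ : ProbabilityMeasure X) :
    pcomb 1 φ ψ = ψ := by
  apply Subtype.ext
  simp [pcomb]

end IntervalAlgebra

section FullyFaithful

/-- The constant affine map with value `y`. -/
def cvxConst (A : CvxCat) {B : CvxCat} (y : B.carrier) : A ⟶ B :=
  ⟨fun _ => y, fun r _ _ => (B.is_convex.idem r y).symm⟩

lemma giryHom_terminal_eq (A : GiryAlg) (u : terminalGiry ⟶ A) :
    u = constHom A (u.1 PUnit.unit) :=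
  Subtype.ext (funext fun _ => rfl)

lemma constHom_comp {A B : GiryAlg} (α : A.carrier) (u : A ⟶ B) :
    constHom A α ≫ u = constHom B (u.1 α) :=
  rfl

variable (F : GiryAlg ⥤ CvxCat)

lemma subsingleton_obj_terminal [F.Full] : Subsingleton (F.obj terminalGiry).carrier := by
  refine ⟨fun x y => ?_⟩
  obtain ⟨u, hu⟩ := F.map_surjective (cvxConst (F.obj terminalGiry) x)
  obtain ⟨v, hv⟩ := F.map_surjective (cvxConst (F.obj terminalGiry) y)
  have huv : u = v := Subtype.ext (funext fun _ => rfl)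
  have h : cvxConst (F.obj terminalGiry) x = cvxConst (F.obj terminalGiry) y := by
    rw [← hu, ← hv, huv]
  exact congrFun (congrArg Subtype.val h) x

lemma nonempty_obj_terminal [F.Faithful] : Nonempty (F.obj terminalGiry).carrier := by
  by_contra hne
  have : IsEmpty (F.obj terminalGiry).carrier := not_nonempty_iff.1 hne
  have h : constHom intervalGiry (0 : unitInterval) = constHom intervalGiry (1 : unitInterval) :=
    F.map_injective (Subtype.ext (funext fun x => isEmptyElim x))
  exact zero_ne_one (α := unitInterval) (congrFun (congrArg Subtype.val h) PUnit.unit)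

variable {F} (star : (F.obj terminalGiry).carrier)

lemma bijective_map_constHom [F.Full] [F.Faithful] (A : GiryAlg) :
    Function.Bijective fun α : A.carrier => (F.map (constHom A α)).1 star := by
  have := subsingleton_obj_terminal F
  constructor
  · intro α β h
    have h' : constHom A α = constHom A β := F.map_injective (Subtype.ext (funext fun x => by
      rw [Subsingleton.elim x star]
      exact h))
    exact congrFun (congrArg Subtype.val h') PUnit.unit
  · intro y
    obtain ⟨u, hu⟩ := F.map_surjective (cvxConst (F.obj terminalGiry) y)
    refine ⟨u.1 PUnit.unit, ?_⟩
    change (F.map (constHom A (u.1 PUnit.unit))).1 star = y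
    rw [← giryHom_terminal_eq, hu]
    rfl

lemma map_map_constHom {A B : GiryAlg} (u : A ⟶ B) (α : A.carrier) :
    (F.map u).1 ((F.map (constHom A α)).1 star) = (F.map (constHom B (u.1 α))).1 star := by
  rw [← constHom_comp, F.map_comp]
  rfl

/-- If the combinations of `0` and `1` in `F(I)` are the images of the weights `f r`, then in
every `F(X,κ)` combining with parameter `r` is the induced combination with parameter `f r`. -/
lemma comb_map_constHom {f : unitInterval → unitInterval}
    (hf : ∀ r, (F.map (constHom intervalGiry (f r))).1 star =
      (F.obj intervalGiry).comb r ((F.map (constHom intervalGiry (0 : unitInterval))).1 star)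
        ((F.map (constHom intervalGiry (1 : unitInterval))).1 star))
    (A : GiryAlg) (r : unitInterval) (α β : A.carrier) :
    (F.obj A).comb r ((F.map (constHom A α)).1 star) ((F.map (constHom A β)).1 star) =
      (F.map (constHom A (A.str (pcomb (f r) (dirac α) (dirac β))))).1 star := by
  have h0 : (segmentHom A α β).1 (0 : unitInterval) = α := by
    change A.str (pcomb 0 _ _) = α
    rw [pcomb_zero, A.str_dirac]
  have h1 : (segmentHom A α β).1 (1 : unitInterval) = β := by
    change A.str (pcomb 1 _ _) = β
    rw [pcomb_one, A.str_dirac]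
  have hnat : ∀ x : unitInterval,
      (F.map (segmentHom A α β)).1 ((F.map (constHom intervalGiry x)).1 star) =
        (F.map (constHom A ((segmentHom A α β).1 x))).1 star :=
    map_map_constHom star (segmentHom A α β)
  have h := congrArg (F.map (segmentHom A α β)).1 (hf r)
  rw [(F.map (segmentHom A α β)).2, hnat, hnat, hnat, h0, h1] at h
  exact h.symm

lemma comb_map_constHom_eq_induced [F.Full] [F.Faithful] (A : GiryAlg) (r : unitInterval)
    (α β : A.carrier) :
    (F.obj A).comb r ((F.map (constHom A α)).1 star) ((F.map (constHom A β)).1 star) =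
      (F.map (constHom A (A.str (pcomb r (dirac α) (dirac β))))).1 star := by
  let τ : unitInterval → (F.obj intervalGiry).carrier :=
    fun x => (F.map (constHom intervalGiry x)).1 star
  have hτ : Function.Bijective τ := bijective_map_constHom star intervalGiry
  choose f hf using fun r => hτ.2 ((F.obj intervalGiry).comb r (τ 0) (τ 1))
  have hcomb : ∀ r x y, (F.obj intervalGiry).comb r (τ x) (τ y)
      = τ (Eop (pcomb (f r) (dirac x) (dirac y))) :=
    comb_map_constHom star hf intervalGiry
  have hconv := (F.obj intervalGiry).is_convex
  have hzero : f 0 = 0 := hτ.1 (by rw [hf, hconv.unit])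
  have hsymm : ∀ r, f (unitInterval.symm r) = unitInterval.symm (f r) := fun r => hτ.1 (by
    rw [hf, hconv.comm, unitInterval.symm_symm, hcomb]
    congr 1
    apply Subtype.ext
    rw [Eop_pcomb_dirac]
    simp)
  have hmul : ∀ a b, f (a * b) = f a * f b := by
    intro a b
    have hab : ((a * b : unitInterval) : ℝ) = a * b := rfl
    rcases eq_or_lt_of_le (a * b).2.1 with h | h
    · have h' : a = 0 ∨ b = 0 := by
        rw [hab] at h
        simpa using h.symm
      rcases h' with rfl | rfl <;> simp [hzero]
    · rw [hab] at h
      have ha : (0 : ℝ) < a := pos_of_mul_pos_left h b.2.1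
      have hle : (a * b : ℝ) ≤ a := mul_le_of_le_one_right a.2.1 b.2.2
      have hle' : (a * b : ℝ) ≤ 1 := hle.trans a.2.2
      let r : unitInterval := ⟨(a - a * b) / (1 - a * b),
        div_nonneg (sub_nonneg.2 hle) (sub_nonneg.2 hle'),
        div_le_one_of_le₀ (by linarith [a.2.2]) (sub_nonneg.2 hle')⟩
      have hr : (a : ℝ) = r + (a * b : unitInterval) - r * (a * b : unitInterval) := by
        change (a : ℝ) = (a - a * b) / (1 - a * b) + a * b - (a - a * b) / (1 - a * b) * (a * b)
        rcases eq_or_ne (1 - (a * b : ℝ)) 0 with h1 | h1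
        · rw [h1]
          simp only [div_zero]
          linarith [a.2.2]
        · field_simp
          ring
      have hb : (b : ℝ) = ((a * b : unitInterval) : ℝ) / a := by
        rw [hab]
        field_simp
      have hassoc := hconv.assoc r (a * b) a b h hr hb (τ 0) (τ 0) (τ 1)
      rw [hconv.idem, ← hf, ← hf, hcomb] at hassoc
      rw [hτ.1 hassoc]
      apply Subtype.ext
      rw [Eop_pcomb_dirac]
      simp
  have hid : ∀ r, f r = r := eq_self_of_multiplicative_of_symm hsymm hmul
  rw [comb_map_constHom star hf, hid]

end FullyFaithful

/-- Any fully faithful covariant functor `F` from the category of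
Giry algebras to the category of convex spaces is naturally isomorphic to the functor
`Φ` equipping each Giry algebra with its induced convex structure: `F(1)` is a
singleton `{*}`, and for each Giry algebra `(X,κ)` the map
`τ_{X,κ} : α ↦ F(ᾱ)(*)` is a bijection, affine from the induced convex structure
`α +ᵣ β = κ((1-r)δ_α + rδ_β)` to `F(X,κ)`, and natural in `(X,κ)`. -/
theorem fullyFaithful_natIso_induced (F : GiryAlg ⥤ CvxCat)
    (hfull : F.Full) (hfaithful : F.Faithful) :
    ∃ star : (F.obj terminalGiry).carrier,
      (∀ y : (F.obj terminalGiry).carrier, y = star) ∧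
      ∀ A : GiryAlg,
        Function.Bijective (fun α : A.carrier => (F.map (constHom A α)).1 star) ∧
        (∀ (r : unitInterval) (α β : A.carrier),
          (F.map (constHom A (A.str (pcomb r (dirac α) (dirac β))))).1 star
            = (F.obj A).comb r ((F.map (constHom A α)).1 star)
                ((F.map (constHom A β)).1 star)) ∧
        (∀ (B : GiryAlg) (u : A ⟶ B) (α : A.carrier),
          (F.map u).1 ((F.map (constHom A α)).1 star)
            = (F.map (constHom B (u.1 α))).1 star) := by
  have := subsingleton_obj_terminal F
  obtain ⟨star⟩ := nonempty_obj_terminal F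
  exact ⟨star, fun y => Subsingleton.elim y star, fun A =>
    ⟨bijective_map_constHom star A,
      fun r α β => (comb_map_constHom_eq_induced star A r α β).symm,
      fun _ u α => map_map_constHom star u α⟩⟩

end Paper
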